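/- Assume the jump-free theorem. Let G = (N^k, Θ) be a downward directed lattice graph equipped with a family ℱ_G of partial selection functions, and let p be a positive integer. Then there exist a finite set D ⊆ N^k and a set E ⊆ N with |E| = p and E^k ⊆ D such that the selection labeling function s_D is regressively regular over E^k; in particular, the set of s_D-significant labels {s_D(z) : z ∈ E^k, s_D(z) < min(z)} has cardinality at most k^k. -/

import Mathlib

namespace LatticeMultiverse

/-- Maximum coordinate value of a lattice point `x ∈ ℕ^k`. -/
noncomputable def vmax {k : ℕ} (x : Fin k → ℕ) : ℕ := sSup (Set.range x)

/-- Minimum coordinate value of a lattice point `x ∈ ℕ^k`. -/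
noncomputable def vmin {k : ℕ} (x : Fin k → ℕ) : ℕ := sInf (Set.range x)

/-- `G = (ℕ^k, Θ)` is a downward directed lattice graph:
every edge `(x, y) ∈ Θ` satisfies `max x > max y`. -/
def Downward {k : ℕ} (Θ : Set ((Fin k → ℕ) × (Fin k → ℕ))) : Prop :=
  ∀ e ∈ Θ, vmax e.2 < vmax e.1

/-- A path in the induced subgraph `G_D`: a nonempty list of distinct vertices of `D`
with consecutive pairs being edges of `Θ` (hence of `Θ_D`). -/
def IsPath {k : ℕ} (Θ : Set ((Fin k → ℕ) × (Fin k → ℕ))) (D : Finset (Fin k → ℕ))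
    (l : List (Fin k → ℕ)) : Prop :=
  l ≠ [] ∧ l.Nodup ∧ (∀ x ∈ l, x ∈ D) ∧ l.Chain' (fun a b => (a, b) ∈ Θ)

/-- A terminal path in `G_D`: a path admitting no one-vertex extension. -/
def IsTerminalPath {k : ℕ} (Θ : Set ((Fin k → ℕ) × (Fin k → ℕ))) (D : Finset (Fin k → ℕ))
    (l : List (Fin k → ℕ)) : Prop :=
  IsPath Θ D l ∧ ∀ y, ¬ IsPath Θ D (l ++ [y])

/-- `T_D(z)`: the set of last vertices of terminal paths in `G_D` starting at `z`. -/
def TD {k : ℕ} (Θ : Set ((Fin k → ℕ) × (Fin k → ℕ))) (D : Finset (Fin k → ℕ))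
    (z : Fin k → ℕ) : Set (Fin k → ℕ) :=
  {w | ∃ l, IsTerminalPath Θ D l ∧ l.head? = some z ∧ l.getLast? = some w}

/-- The terminal label function `t_D(z) = min({min x : x ∈ T_D(z)} ∪ {min z})`. -/
noncomputable def tD {k : ℕ} (Θ : Set ((Fin k → ℕ) × (Fin k → ℕ))) (D : Finset (Fin k → ℕ))
    (z : Fin k → ℕ) : ℕ :=
  sInf (vmin '' TD Θ D z ∪ {vmin z})

open Classical in
/-- The relaxed terminal label function `t̂_D`: `max z` if the one-vertex path `(z)` is
terminal in `G_D`, and `t_D z` otherwise. -/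
noncomputable def tDhat {k : ℕ} (Θ : Set ((Fin k → ℕ) × (Fin k → ℕ))) (D : Finset (Fin k → ℕ))
    (z : Fin k → ℕ) : ℕ :=
  if IsTerminalPath Θ D [z] then vmax z else tD Θ D z

/-- Two `k`-tuples have the same order type. -/
def SameOrderType {k : ℕ} (x y : Fin k → ℕ) : Prop :=
  (∀ i j, x i < x j ↔ y i < y j) ∧ (∀ i j, x i = x j ↔ y i = y j)

/-- The cube `E^k ⊆ ℕ^k`. -/
def cube (k : ℕ) (E : Finset ℕ) : Finset (Fin k → ℕ) := Fintype.piFinset fun _ => E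

/-- `f` is regressively regular over `E^k`: for each order type of `k`-tuples,
either `f x ≥ min x` for all `x ∈ E^k` of that order type, or
`f x = f y < min E` for all `x, y ∈ E^k` of that order type. -/
def RegressivelyRegular {k : ℕ} (E : Finset ℕ) (f : (Fin k → ℕ) → ℕ) : Prop :=
  ∀ x ∈ cube k E,
    (∀ y ∈ cube k E, SameOrderType x y → vmin y ≤ f y) ∨
    (∀ y ∈ cube k E, ∀ z ∈ cube k E, SameOrderType x y → SameOrderType x z →
      f y = f z ∧ f y < sInf (E : Set ℕ))

/-- The set of `f`-significant labels of `S`: `{f z : z ∈ S, f z < min z}`. -/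
def sigLabels {k : ℕ} (f : (Fin k → ℕ) → ℕ) (S : Set (Fin k → ℕ)) : Set ℕ :=
  f '' {z ∈ S | f z < vmin z}

/-- A family of functions with finite domains is encoded as a set of pairs `(D, f)`,
`D` the domain.  Full: every finite `D` is the domain of some member. -/
def FullFam {k : ℕ} (Q : Set (Finset (Fin k → ℕ) × ((Fin k → ℕ) → ℕ))) : Prop :=
  ∀ D, ∃ f, (D, f) ∈ Q

/-- Reflexive: each value `f x`, `x ∈ D`, is a coordinate of some `y ∈ D`. -/
def ReflexiveFam {k : ℕ} (Q : Set (Finset (Fin k → ℕ) × ((Fin k → ℕ) → ℕ))) : Prop :=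
  ∀ p ∈ Q, ∀ x ∈ p.1, ∃ y ∈ p.1, ∃ i, p.2 x = y i

/-- Jump-free: if `x ∈ A ∩ B`, `A_x ⊆ B_x` and `f_A = f_B` on `A_x`, then `f_A x ≥ f_B x`. -/
def JumpFreeFam {k : ℕ} (Q : Set (Finset (Fin k → ℕ) × ((Fin k → ℕ) → ℕ))) : Prop :=
  ∀ A ∈ Q, ∀ B ∈ Q, ∀ x, x ∈ A.1 → x ∈ B.1 →
    (∀ z ∈ A.1, vmax z < vmax x → z ∈ B.1) →
    (∀ y ∈ A.1, vmax y < vmax x → A.2 y = B.2 y) →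
    B.2 x ≤ A.2 x

/-- Friedman's jump-free theorem (independent of ZFC), stated as a proposition to be
assumed as a hypothesis: for every full, reflexive, jump-free family `Q` on `ℕ^k` and
every `p > 0` there are a finite `D`, an `E` with `|E| = p` and `E^k ⊆ D`, and an
`f ∈ Q` with domain `D` that is regressively regular over `E^k`. -/
def JumpFreeTheorem (k : ℕ) : Prop :=
  ∀ Q : Set (Finset (Fin k → ℕ) × ((Fin k → ℕ) → ℕ)),
    FullFam Q → ReflexiveFam Q → JumpFreeFam Q →
    ∀ p : ℕ, 0 < p →
      ∃ D E f, (D, f) ∈ Q ∧ E.card = p ∧ cube k E ⊆ D ∧ RegressivelyRegular E f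

/-- `ℱ_G = {F^x_r}` is a family of partial selection functions on the out-neighborhoods
of `G = (ℕ^k, Θ)`: `F x r` is the partial function `F^x_r : (G^x × ℕ)^r ⇀ ℕ`
(`none` = undefined); whenever defined, its value is one of the `n_i`, and its domain
consists of tuples whose first components are out-neighbors of `x`. -/
def IsSelectionFamily {k : ℕ} (Θ : Set ((Fin k → ℕ) × (Fin k → ℕ)))
    (F : (Fin k → ℕ) → (r : ℕ) → (Fin r → (Fin k → ℕ) × ℕ) → Option ℕ) : Prop :=
  ∀ x r args n, F x r args = some n → (∃ i, n = (args i).2) ∧ ∀ i, (x, (args i).1) ∈ Θ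

/-- `Φ^D_x` relative to a labeling `g`: all defined values
`F^x_r((y₁, g y₁), …, (y_r, g y_r))` with `r ≥ 1` and `y₁, …, y_r ∈ G^x_D`. -/
def Phi {k : ℕ} (Θ : Set ((Fin k → ℕ) × (Fin k → ℕ)))
    (F : (Fin k → ℕ) → (r : ℕ) → (Fin r → (Fin k → ℕ) × ℕ) → Option ℕ)
    (D : Finset (Fin k → ℕ)) (g : (Fin k → ℕ) → ℕ) (x : Fin k → ℕ) : Set ℕ :=
  {n | ∃ r, 1 ≤ r ∧ ∃ y : Fin r → (Fin k → ℕ),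
    ∃ _ : ∀ i, y i ∈ D ∧ (x, y i) ∈ Θ,
    F x r (fun i => (y i, g (y i))) = some n}

open Classical in
/-- The selection labeling function `s_D`, defined by recursion on `vmax x`:
`s_D x = min Φ^D_x` if `Φ^D_x ≠ ∅` (where `Φ^D_x = Phi Θ F D (s_D) x`), and
`s_D x = min x` otherwise. -/
noncomputable def sD {k : ℕ} (Θ : Set ((Fin k → ℕ) × (Fin k → ℕ))) (hΘ : Downward Θ)
    (F : (Fin k → ℕ) → (r : ℕ) → (Fin r → (Fin k → ℕ) × ℕ) → Option ℕ)
    (D : Finset (Fin k → ℕ)) (x : Fin k → ℕ) : ℕ :=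
  let Φ : Set ℕ := {n | ∃ r, 1 ≤ r ∧ ∃ y : Fin r → (Fin k → ℕ),
    ∃ _ : ∀ i, y i ∈ D ∧ (x, y i) ∈ Θ,
    F x r (fun i => (y i, sD Θ hΘ F D (y i))) = some n}
  if Φ.Nonempty then sInf Φ else vmin x
termination_by vmax x
decreasing_by
  have h : ∀ i, y i ∈ D ∧ (x, y i) ∈ Θ := by assumption
  exact hΘ _ (h i).2

open Classical in
/-- The relaxed selection labeling function `ŝ_D`: `s_D x` if `Φ^D_x ≠ ∅`,
and `max x` otherwise. -/
noncomputable def sDhat {k : ℕ} (Θ : Set ((Fin k → ℕ) × (Fin k → ℕ))) (hΘ : Downward Θ)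
    (F : (Fin k → ℕ) → (r : ℕ) → (Fin r → (Fin k → ℕ) × ℕ) → Option ℕ)
    (D : Finset (Fin k → ℕ)) (x : Fin k → ℕ) : ℕ :=
  if (Phi Θ F D (sD Θ hΘ F D) x).Nonempty then sD Θ hΘ F D x else vmax x

/-- The maximal downward edge set `Θ = {(x, y) : max x > max y}`. -/
def maxTheta (k : ℕ) : Set ((Fin k → ℕ) × (Fin k → ℕ)) := {e | vmax e.2 < vmax e.1}

theorem maxTheta_downward (k : ℕ) : Downward (maxTheta k) := fun _ he => he

section Coordinates

variable {k : ℕ}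

theorem le_vmax (x : Fin k → ℕ) (i : Fin k) : x i ≤ vmax x :=
  le_csSup (Set.finite_range x).bddAbove (Set.mem_range_self i)

theorem vmin_le (x : Fin k → ℕ) (i : Fin k) : vmin x ≤ x i :=
  Nat.sInf_le (Set.mem_range_self i)

theorem exists_eq_vmax (hk : 0 < k) (x : Fin k → ℕ) : ∃ i, x i = vmax x :=
  haveI : Nonempty (Fin k) := ⟨⟨0, hk⟩⟩
  Nat.sSup_mem (Set.range_nonempty x) (Set.finite_range x).bddAbove

theorem exists_eq_vmin (hk : 0 < k) (x : Fin k → ℕ) : ∃ i, x i = vmin x :=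
  haveI : Nonempty (Fin k) := ⟨⟨0, hk⟩⟩
  Nat.sInf_mem (Set.range_nonempty x)

theorem vmin_le_vmax (hk : 0 < k) (x : Fin k → ℕ) : vmin x ≤ vmax x :=
  (vmin_le x ⟨0, hk⟩).trans (le_vmax x _)

theorem sInf_le_vmax_of_mem_cube (hk : 0 < k) {E : Finset ℕ} {x : Fin k → ℕ}
    (hx : x ∈ cube k E) : sInf (E : Set ℕ) ≤ vmax x :=
  (Nat.sInf_le (Finset.mem_coe.2 (Fintype.mem_piFinset.1 hx ⟨0, hk⟩))).trans (le_vmax x _)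

end Coordinates

section OrderType

variable {k : ℕ}

theorem SameOrderType.refl (x : Fin k → ℕ) : SameOrderType x x :=
  ⟨fun _ _ => Iff.rfl, fun _ _ => Iff.rfl⟩

/-- The rank vector of a tuple: the `i`-th entry counts the coordinates below `x i`. -/
def rankVector (x : Fin k → ℕ) (i : Fin k) : Fin k :=
  ⟨(Finset.univ.filter fun j => x j < x i).card, by
    have h : (Finset.univ.filter fun j => x j < x i) ⊂ Finset.univ :=
      Finset.filter_ssubset.2 ⟨i, Finset.mem_univ i, lt_irrefl _⟩
    simpa using Finset.card_lt_card h⟩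

theorem rankVector_lt_iff (x : Fin k → ℕ) (i j : Fin k) :
    rankVector x i < rankVector x j ↔ x i < x j := by
  have mono : ∀ {a b : Fin k}, x a ≤ x b → rankVector x a ≤ rankVector x b := by
    intro a b h
    simp only [rankVector, Fin.mk_le_mk]
    exact Finset.card_le_card (Finset.monotone_filter_right _ fun _ _ hc => lt_of_lt_of_le hc h)
  refine ⟨fun h => ?_, fun h => ?_⟩
  · by_contra hn
    exact absurd h (mono (not_lt.1 hn)).not_gt
  · simp only [rankVector, Fin.mk_lt_mk]
    refine Finset.card_lt_card (Finset.ssubset_iff_of_subset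
      (Finset.monotone_filter_right _ fun _ _ hc => lt_trans hc h) |>.2 ⟨i, ?_, ?_⟩)
    · simpa using h
    · simp

theorem sameOrderType_of_rankVector_eq {x y : Fin k → ℕ} (h : rankVector x = rankVector y) :
    SameOrderType x y := by
  have lt : ∀ i j, x i < x j ↔ y i < y j := fun i j => by
    rw [← rankVector_lt_iff x, ← rankVector_lt_iff y, h]
  refine ⟨lt, fun i j => ?_⟩
  have h₁ := lt i j
  have h₂ := lt j i
  omega

/-- A regressively regular function has at most `k ^ k` significant labels on the cube. -/
theorem RegressivelyRegular.ncard_sigLabels_le {E : Finset ℕ} {f : (Fin k → ℕ) → ℕ}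
    (h : RegressivelyRegular E f) :
    (sigLabels f (cube k E : Set (Fin k → ℕ))).ncard ≤ k ^ k := by
  choose! z hz hfz using
    fun n (hn : n ∈ sigLabels f (cube k E : Set (Fin k → ℕ))) => hn
  have inj : Set.InjOn (fun n => rankVector (z n))
      (sigLabels f (cube k E : Set (Fin k → ℕ))) := by
    intro m hm n hn hmn
    rcases h (z m) (hz m hm).1 with hge | heq
    · exact absurd (hz m hm).2 (hge _ (hz m hm).1 (.refl _)).not_gt
    · rw [← hfz m hm, ← hfz n hn]
      exact (heq _ (hz m hm).1 _ (hz n hn).1 (.refl _) (sameOrderType_of_rankVector_eq hmn)).1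
  calc (sigLabels f (cube k E : Set (Fin k → ℕ))).ncard
      ≤ (Set.univ : Set (Fin k → Fin k)).ncard :=
        Set.ncard_le_ncard_of_injOn _ (fun _ _ => Set.mem_univ _) inj
    _ = k ^ k := by simp [Set.ncard_univ]

end OrderType

section SelectionLabeling

variable {k : ℕ} {Θ : Set ((Fin k → ℕ) × (Fin k → ℕ))} {hΘ : Downward Θ}
  {F : (Fin k → ℕ) → (r : ℕ) → (Fin r → (Fin k → ℕ) × ℕ) → Option ℕ}

open Classical in
theorem sD_eq (D : Finset (Fin k → ℕ)) (x : Fin k → ℕ) :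
    sD Θ hΘ F D x =
      if (Phi Θ F D (sD Θ hΘ F D) x).Nonempty then sInf (Phi Θ F D (sD Θ hΘ F D) x)
      else vmin x := by
  rw [sD]
  rfl

theorem sD_mem_Phi {D : Finset (Fin k → ℕ)} {x : Fin k → ℕ}
    (h : (Phi Θ F D (sD Θ hΘ F D) x).Nonempty) :
    sD Θ hΘ F D x ∈ Phi Θ F D (sD Θ hΘ F D) x := by
  have := Nat.sInf_mem h
  rwa [sD_eq, if_pos h]

theorem sD_le_of_mem_Phi {D : Finset (Fin k → ℕ)} {x : Fin k → ℕ} {n : ℕ}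
    (h : n ∈ Phi Θ F D (sD Θ hΘ F D) x) : sD Θ hΘ F D x ≤ n := by
  rw [sD_eq, if_pos ⟨n, h⟩]
  exact Nat.sInf_le h

theorem sD_of_Phi_empty {D : Finset (Fin k → ℕ)} {x : Fin k → ℕ}
    (h : ¬ (Phi Θ F D (sD Θ hΘ F D) x).Nonempty) : sD Θ hΘ F D x = vmin x := by
  rw [sD_eq, if_neg h]

theorem exists_eq_of_mem_Phi (hF : IsSelectionFamily Θ F) {D : Finset (Fin k → ℕ)}
    {g : (Fin k → ℕ) → ℕ} {x : Fin k → ℕ} {n : ℕ} (h : n ∈ Phi Θ F D g x) :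
    ∃ y ∈ D, (x, y) ∈ Θ ∧ g y = n := by
  obtain ⟨r, -, y, hy, hn⟩ := h
  obtain ⟨i, hi⟩ := (hF _ _ _ _ hn).1
  exact ⟨y i, (hy i).1, (hy i).2, hi.symm⟩

/-- Every label is the minimum of `x` itself or of a point of `D` with smaller maximum. -/
theorem exists_sD_eq_vmin (hF : IsSelectionFamily Θ F) (D : Finset (Fin k → ℕ))
    (x : Fin k → ℕ) :
    ∃ y, (y = x ∨ y ∈ D) ∧ vmax y ≤ vmax x ∧ sD Θ hΘ F D x = vmin y := by
  induction hm : vmax x using Nat.strong_induction_on generalizing x with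
  | _ m ih =>
    subst hm
    by_cases h : (Phi Θ F D (sD Θ hΘ F D) x).Nonempty
    · obtain ⟨y, hyD, hxy, hy⟩ := exists_eq_of_mem_Phi hF (sD_mem_Phi h)
      have hlt : vmax y < vmax x := hΘ _ hxy
      obtain ⟨w, hw, hwy, hyw⟩ := ih _ hlt y rfl
      exact ⟨w, .inr (hw.elim (fun e => e ▸ hyD) id), hwy.trans hlt.le, hy.symm.trans hyw⟩
    · exact ⟨x, .inl rfl, le_rfl, sD_of_Phi_empty h⟩

theorem sD_le_vmax (hk : 0 < k) (hF : IsSelectionFamily Θ F) (D : Finset (Fin k → ℕ))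
    (x : Fin k → ℕ) : sD Θ hΘ F D x ≤ vmax x := by
  obtain ⟨y, -, hyx, hy⟩ := exists_sD_eq_vmin (hΘ := hΘ) hF D x
  exact hy ▸ (vmin_le_vmax hk y).trans hyx

theorem sD_lt_vmax (hk : 0 < k) (hF : IsSelectionFamily Θ F) {D : Finset (Fin k → ℕ)}
    {x : Fin k → ℕ} (h : (Phi Θ F D (sD Θ hΘ F D) x).Nonempty) :
    sD Θ hΘ F D x < vmax x := by
  obtain ⟨y, -, hxy, hy⟩ := exists_eq_of_mem_Phi hF (sD_mem_Phi h)
  exact hy ▸ (sD_le_vmax hk hF D y).trans_lt (hΘ _ hxy)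

theorem sDhat_of_Phi_nonempty {D : Finset (Fin k → ℕ)} {x : Fin k → ℕ}
    (h : (Phi Θ F D (sD Θ hΘ F D) x).Nonempty) : sDhat Θ hΘ F D x = sD Θ hΘ F D x :=
  if_pos h

theorem sDhat_of_Phi_empty {D : Finset (Fin k → ℕ)} {x : Fin k → ℕ}
    (h : ¬ (Phi Θ F D (sD Θ hΘ F D) x).Nonempty) : sDhat Θ hΘ F D x = vmax x :=
  if_neg h

theorem sDhat_le_vmax (hk : 0 < k) (hF : IsSelectionFamily Θ F) (D : Finset (Fin k → ℕ))
    (x : Fin k → ℕ) : sDhat Θ hΘ F D x ≤ vmax x := by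
  by_cases h : (Phi Θ F D (sD Θ hΘ F D) x).Nonempty
  · exact (sDhat_of_Phi_nonempty h).trans_le (sD_le_vmax hk hF D x)
  · exact (sDhat_of_Phi_empty h).le

theorem sDhat_lt_vmax_iff (hk : 0 < k) (hF : IsSelectionFamily Θ F) {D : Finset (Fin k → ℕ)}
    {x : Fin k → ℕ} :
    sDhat Θ hΘ F D x < vmax x ↔ (Phi Θ F D (sD Θ hΘ F D) x).Nonempty := by
  refine ⟨fun h => ?_, fun h => (sDhat_of_Phi_nonempty h).trans_lt (sD_lt_vmax hk hF h)⟩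
  by_contra hn
  exact h.ne (sDhat_of_Phi_empty hn)

/-- The relaxed label determines the label. -/
theorem sD_eq_of_sDhat_eq (hk : 0 < k) (hF : IsSelectionFamily Θ F)
    {A B : Finset (Fin k → ℕ)} {x : Fin k → ℕ} (h : sDhat Θ hΘ F A x = sDhat Θ hΘ F B x) :
    sD Θ hΘ F A x = sD Θ hΘ F B x := by
  by_cases hA : (Phi Θ F A (sD Θ hΘ F A) x).Nonempty
  · have hB := (sDhat_lt_vmax_iff hk hF).1 (h ▸ (sDhat_lt_vmax_iff hk hF).2 hA)
    rwa [sDhat_of_Phi_nonempty hA, sDhat_of_Phi_nonempty hB] at h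
  · have hB : ¬ (Phi Θ F B (sD Θ hΘ F B) x).Nonempty := fun hB =>
      hA ((sDhat_lt_vmax_iff hk hF).1 (h ▸ (sDhat_lt_vmax_iff hk hF).2 hB))
    rw [sD_of_Phi_empty hA, sD_of_Phi_empty hB]

theorem Phi_subset_Phi (hΘ : Downward Θ) {A B : Finset (Fin k → ℕ)} {f g : (Fin k → ℕ) → ℕ}
    {x : Fin k → ℕ} (hAB : ∀ y ∈ A, vmax y < vmax x → y ∈ B)
    (hfg : ∀ y ∈ A, vmax y < vmax x → f y = g y) : Phi Θ F A f x ⊆ Phi Θ F B g x := by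
  rintro n ⟨r, hr, y, hy, hn⟩
  have hlt : ∀ i, vmax (y i) < vmax x := fun i => hΘ _ (hy i).2
  refine ⟨r, hr, y, fun i => ⟨hAB _ (hy i).1 (hlt i), (hy i).2⟩, ?_⟩
  have heq : (fun i => (y i, g (y i))) = fun i => (y i, f (y i)) :=
    funext fun i => by rw [hfg _ (hy i).1 (hlt i)]
  rwa [heq]

variable (hΘ F) in
/-- The family of all relaxed selection labelings. -/
def sDhatFamily : Set (Finset (Fin k → ℕ) × ((Fin k → ℕ) → ℕ)) :=
  Set.range fun D => (D, sDhat Θ hΘ F D)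

theorem fullFam_sDhatFamily : FullFam (sDhatFamily hΘ F) :=
  fun D => ⟨_, D, rfl⟩

theorem reflexiveFam_sDhatFamily (hk : 0 < k) (hF : IsSelectionFamily Θ F) :
    ReflexiveFam (sDhatFamily hΘ F) := by
  rintro _ ⟨D, rfl⟩ x hx
  by_cases h : (Phi Θ F D (sD Θ hΘ F D) x).Nonempty
  · obtain ⟨y, hy, -, hxy⟩ := exists_sD_eq_vmin (hΘ := hΘ) hF D x
    obtain ⟨i, hi⟩ := exists_eq_vmin hk y
    exact ⟨y, hy.elim (fun e => e ▸ hx) id, i,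
      (sDhat_of_Phi_nonempty h).trans (hxy.trans hi.symm)⟩
  · obtain ⟨i, hi⟩ := exists_eq_vmax hk x
    exact ⟨x, hx, i, (sDhat_of_Phi_empty h).trans hi.symm⟩

theorem jumpFreeFam_sDhatFamily (hk : 0 < k) (hF : IsSelectionFamily Θ F) :
    JumpFreeFam (sDhatFamily hΘ F) := by
  rintro _ ⟨A, rfl⟩ _ ⟨B, rfl⟩ x - - hAB heq
  have hsub : Phi Θ F A (sD Θ hΘ F A) x ⊆ Phi Θ F B (sD Θ hΘ F B) x :=
    Phi_subset_Phi hΘ hAB fun y hy hyx => sD_eq_of_sDhat_eq hk hF (heq y hy hyx)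
  change sDhat Θ hΘ F B x ≤ sDhat Θ hΘ F A x
  by_cases hA : (Phi Θ F A (sD Θ hΘ F A) x).Nonempty
  · rw [sDhat_of_Phi_nonempty hA, sDhat_of_Phi_nonempty (hA.mono hsub)]
    exact sD_le_of_mem_Phi (hsub (sD_mem_Phi hA))
  · exact (sDhat_le_vmax hk hF B x).trans_eq (sDhat_of_Phi_empty hA).symm

/-- Regressive regularity passes from the relaxed labeling to the labeling. -/
theorem RegressivelyRegular.sD_of_sDhat (hk : 0 < k) (hF : IsSelectionFamily Θ F)
    {D : Finset (Fin k → ℕ)} {E : Finset ℕ} (h : RegressivelyRegular E (sDhat Θ hΘ F D)) :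
    RegressivelyRegular E (sD Θ hΘ F D) := by
  intro x hx
  refine (h x hx).imp (fun hge y hy hxy => ?_) fun heq => ?_
  · by_cases hΦ : (Phi Θ F D (sD Θ hΘ F D) y).Nonempty
    · exact sDhat_of_Phi_nonempty hΦ ▸ hge y hy hxy
    · exact (sD_of_Phi_empty hΦ).ge
  · have key : ∀ y ∈ cube k E, SameOrderType x y → sDhat Θ hΘ F D y = sD Θ hΘ F D y :=
      fun y hy hxy => sDhat_of_Phi_nonempty <| (sDhat_lt_vmax_iff hk hF).1 <|
        (heq y hy y hy hxy hxy).2.trans_le (sInf_le_vmax_of_mem_cube hk hy)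
    intro y hy z hz hxy hxz
    rw [← key y hy hxy, ← key z hz hxz]
    exact heq y hy z hz hxy hxz

end SelectionLabeling

/-- Multiverse SL (Theorem 3.4): assuming the jump-free theorem, for every downward
directed lattice graph `G = (ℕ^k, Θ)` equipped with a family of partial selection
functions and every `p > 0` there are a finite `D ⊆ ℕ^k` and `E ⊆ ℕ` with `|E| = p`,
`E^k ⊆ D`, such that `s_D` is regressively regular over `E^k`; in particular the set of
`s_D`-significant labels of `E^k` has at most `k^k` elements. -/
theorem multiverse_SL {k : ℕ} (hk : 2 ≤ k) (hJF : JumpFreeTheorem k)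
    (Θ : Set ((Fin k → ℕ) × (Fin k → ℕ))) (hΘ : Downward Θ)
    (F : (Fin k → ℕ) → (r : ℕ) → (Fin r → (Fin k → ℕ) × ℕ) → Option ℕ)
    (hF : IsSelectionFamily Θ F)
    (p : ℕ) (hp : 0 < p) :
    ∃ (D : Finset (Fin k → ℕ)) (E : Finset ℕ),
      E.card = p ∧ cube k E ⊆ D ∧
      RegressivelyRegular E (sD Θ hΘ F D) ∧
      (sigLabels (sD Θ hΘ F D) (cube k E : Set (Fin k → ℕ))).ncard ≤ k ^ k := by
  have hk₀ : 0 < k := by omega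
  obtain ⟨_, E, _, ⟨D, hD⟩, hE, hED, hreg⟩ := hJF (sDhatFamily hΘ F) fullFam_sDhatFamily
    (reflexiveFam_sDhatFamily hk₀ hF) (jumpFreeFam_sDhatFamily hk₀ hF) p hp
  obtain ⟨rfl, rfl⟩ := Prod.mk.inj hD
  have hs := RegressivelyRegular.sD_of_sDhat hk₀ hF hreg
  exact ⟨D, E, hE, hED, hs, hs.ncard_sigLabels_le⟩

end LatticeMultiverse
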